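/- Let Φ be an integral domain, let A_0 be a fixed system of representatives (containing the identity) of the left cosets of H(Φ) = GL_3(Φ) ∩ B_3(Φ) in GL_3(Φ), and let B_0 = {(x_1+h(x_2,x_3), x_2, x_3) : h ∈ [L_3(Φ),L_3(Φ)]}. Then every tame automorphism φ of L_3(Φ) can be written in the form φ = σ_1 ∘ τ_1 ∘ σ_2 ∘ τ_2 ∘ ⋯ ∘ σ_k ∘ τ_k ∘ λ, where σ_i ∈ A_0 with σ_2,…,σ_k ≠ id, τ_i ∈ B_0 with τ_1,…,τ_k ≠ id, and λ ∈ GL_3(Φ). -/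

import Mathlib

/-- The group structure (under composition) on the Lie algebra automorphisms. -/
noncomputable instance lieAutGroup (Φ : Type*) [CommRing Φ] (L : Type*)
    [LieRing L] [LieAlgebra Φ L] : Group (L ≃ₗ⁅Φ⁆ L) where
  mul e f := f.trans e
  one := LieEquiv.refl
  inv := LieEquiv.symm
  mul_assoc e f g := rfl
  one_mul e := rfl
  mul_one e := rfl
  inv_mul_cancel e := LieEquiv.ext fun x => e.symm_apply_apply x

/-- The free generators `x_1, x_2, x_3` of `L_3(Φ) = L_Φ⟨x_1,x_2,x_3⟩`. -/
noncomputable def xg (Φ : Type*) [CommRing Φ] (i : Fin 3) :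
    FreeLieAlgebra Φ (Fin 3) :=
  FreeLieAlgebra.of Φ i

/-- A linear automorphism of `L_3(Φ)`: each generator is sent to a `Φ`-linear
combination of the generators (membership in `GL_3(Φ)`). -/
def IsLinearAut (Φ : Type*) [CommRing Φ]
    (φ : FreeLieAlgebra Φ (Fin 3) ≃ₗ⁅Φ⁆ FreeLieAlgebra Φ (Fin 3)) : Prop :=
  ∀ i : Fin 3, φ (xg Φ i) ∈ Submodule.span Φ (Set.range (xg Φ))

/-- A triangular automorphism of `L_3(Φ)` (membership in `B_3(Φ)`):
`μ = (α₁x₁ + h(x₂,x₃), β₂x₂ + β₃x₃, γ₂x₂ + γ₃x₃)` with `α₁` and `β₂γ₃ - β₃γ₂`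
units of `Φ` and `h` in the subalgebra generated by `x₂, x₃`. -/
def IsTriangularAut (Φ : Type*) [CommRing Φ]
    (φ : FreeLieAlgebra Φ (Fin 3) ≃ₗ⁅Φ⁆ FreeLieAlgebra Φ (Fin 3)) : Prop :=
  ∃ (α₁ β₂ β₃ γ₂ γ₃ : Φ) (h : FreeLieAlgebra Φ (Fin 3)),
    IsUnit α₁ ∧ IsUnit (β₂ * γ₃ - β₃ * γ₂) ∧
    h ∈ LieSubalgebra.lieSpan Φ (FreeLieAlgebra Φ (Fin 3)) {xg Φ 1, xg Φ 2} ∧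
    φ (xg Φ 0) = α₁ • xg Φ 0 + h ∧
    φ (xg Φ 1) = β₂ • xg Φ 1 + β₃ • xg Φ 2 ∧
    φ (xg Φ 2) = γ₂ • xg Φ 1 + γ₃ • xg Φ 2

/-- Membership in the set `B₀ = {τ = (x₁ + h(x₂,x₃), x₂, x₃) : h ∈ [L₃(Φ),L₃(Φ)]}`. -/
def IsB0Aut (Φ : Type*) [CommRing Φ]
    (τ : FreeLieAlgebra Φ (Fin 3) ≃ₗ⁅Φ⁆ FreeLieAlgebra Φ (Fin 3)) : Prop :=
  ∃ h : FreeLieAlgebra Φ (Fin 3),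
    h ∈ LieSubalgebra.lieSpan Φ (FreeLieAlgebra Φ (Fin 3)) {xg Φ 1, xg Φ 2} ∧
    h ∈ LieAlgebra.derivedSeries Φ (FreeLieAlgebra Φ (Fin 3)) 1 ∧
    τ (xg Φ 0) = xg Φ 0 + h ∧ τ (xg Φ 1) = xg Φ 1 ∧ τ (xg Φ 2) = xg Φ 2

/-- An elementary automorphism of `L_3(Φ)`: for some `i`, it sends `x_i` to
`α • x_i + f` with `α` a unit of `Φ` and `f` in the subalgebra generated by the
other two generators, and fixes the other generators. -/
def IsElementaryAut (Φ : Type*) [CommRing Φ]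
    (φ : FreeLieAlgebra Φ (Fin 3) ≃ₗ⁅Φ⁆ FreeLieAlgebra Φ (Fin 3)) : Prop :=
  ∃ (i : Fin 3) (α : Φ) (f : FreeLieAlgebra Φ (Fin 3)), IsUnit α ∧
    f ∈ LieSubalgebra.lieSpan Φ (FreeLieAlgebra Φ (Fin 3)) (xg Φ '' {j | j ≠ i}) ∧
    φ (xg Φ i) = α • xg Φ i + f ∧ ∀ j : Fin 3, j ≠ i → φ (xg Φ j) = xg Φ j

/-- A tame automorphism of `L_3(Φ)`: an element of the subgroup generated by the
elementary automorphisms. -/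
def IsTameAut (Φ : Type*) [CommRing Φ]
    (φ : FreeLieAlgebra Φ (Fin 3) ≃ₗ⁅Φ⁆ FreeLieAlgebra Φ (Fin 3)) : Prop :=
  φ ∈ Subgroup.closure {ψ | IsElementaryAut Φ ψ}

/-- `A₀` is a system of representatives, containing the identity, of the left cosets
of `H(Φ) = GL₃(Φ) ∩ B₃(Φ)` in `GL₃(Φ)`. -/
def IsA0System (Φ : Type*) [CommRing Φ]
    (A0 : Set (FreeLieAlgebra Φ (Fin 3) ≃ₗ⁅Φ⁆ FreeLieAlgebra Φ (Fin 3))) : Prop :=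
  (1 ∈ A0) ∧ (∀ a ∈ A0, IsLinearAut Φ a) ∧
  (∀ σ, IsLinearAut Φ σ → ∃ a ∈ A0,
    IsLinearAut Φ (a⁻¹ * σ) ∧ IsTriangularAut Φ (a⁻¹ * σ)) ∧
  (∀ a ∈ A0, ∀ a' ∈ A0, a ≠ a' →
    ¬ (IsLinearAut Φ (a⁻¹ * a') ∧ IsTriangularAut Φ (a⁻¹ * a')))

section FreeLieThree

open LieAlgebra

variable {Φ : Type*} [CommRing Φ]

/-- The free Lie algebra on three generators. -/
abbrev FreeLieThree (Φ : Type*) [CommRing Φ] := FreeLieAlgebra Φ (Fin 3)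

/-- The automorphisms of the free Lie algebra on three generators. -/
abbrev FreeLieThreeAut (Φ : Type*) [CommRing Φ] := FreeLieThree Φ ≃ₗ⁅Φ⁆ FreeLieThree Φ

lemma lieAut_mul_apply (e f : FreeLieThreeAut Φ) (v : FreeLieThree Φ) : (e * f) v = e (f v) := rfl

lemma lieAut_apply_inv_apply (e : FreeLieThreeAut Φ) (v : FreeLieThree Φ) : e (e⁻¹ v) = v :=
  e.apply_symm_apply v

lemma lieAut_inv_apply_apply (e : FreeLieThreeAut Φ) (v : FreeLieThree Φ) : e⁻¹ (e v) = v :=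
  e.symm_apply_apply v

lemma lieAut_inv_apply_eq {e : FreeLieThreeAut Φ} {v w : FreeLieThree Φ} (h : e v = w) :
    e⁻¹ w = v := by
  rw [← h, lieAut_inv_apply_apply]

lemma lieHom_ext_xg {f g : FreeLieThree Φ →ₗ⁅Φ⁆ FreeLieThree Φ}
    (h : ∀ i, f (xg Φ i) = g (xg Φ i)) : f = g :=
  FreeLieAlgebra.hom_ext h

lemma lift_xg (f : Fin 3 → FreeLieThree Φ) (i : Fin 3) :
    FreeLieAlgebra.lift Φ f (xg Φ i) = f i :=
  FreeLieAlgebra.lift_of_apply f i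

lemma exists_lieAut (f g : Fin 3 → FreeLieThree Φ)
    (hfg : ∀ i, FreeLieAlgebra.lift Φ f (g i) = xg Φ i)
    (hgf : ∀ i, FreeLieAlgebra.lift Φ g (f i) = xg Φ i) :
    ∃ e : FreeLieThreeAut Φ, ∀ i, e (xg Φ i) = f i := by
  have h₁ : (FreeLieAlgebra.lift Φ g).comp (FreeLieAlgebra.lift Φ f) = LieHom.id :=
    lieHom_ext_xg fun i => by simp [lift_xg, hgf]
  have h₂ : (FreeLieAlgebra.lift Φ f).comp (FreeLieAlgebra.lift Φ g) = LieHom.id :=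
    lieHom_ext_xg fun i => by simp [lift_xg, hfg]
  exact ⟨{ FreeLieAlgebra.lift Φ f with
    invFun := FreeLieAlgebra.lift Φ g
    left_inv := fun v => LieHom.congr_fun h₁ v
    right_inv := fun v => LieHom.congr_fun h₂ v }, lift_xg f⟩

lemma lie_mem_derivedSeries_one {L : Type*} [LieRing L] [LieAlgebra Φ L] (v w : L) :
    ⁅v, w⁆ ∈ derivedSeries Φ L 1 := by
  rw [derivedSeries_def, derivedSeriesOfIdeal_succ, derivedSeriesOfIdeal_zero]
  exact LieSubmodule.lie_mem_lie (LieSubmodule.mem_top v) (LieSubmodule.mem_top w)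

lemma map_mem_derivedSeries_one (e : FreeLieThreeAut Φ) {d : FreeLieThree Φ}
    (hd : d ∈ derivedSeries Φ (FreeLieThree Φ) 1) :
    e d ∈ derivedSeries Φ (FreeLieThree Φ) 1 :=
  LieIdeal.derivedSeries_map_le (f := e.toLieHom) 1 (LieIdeal.mem_map hd)

lemma exists_linear_add_derived {L : Type*} [LieRing L] [LieAlgebra Φ L] {S : Set L} {v : L}
    (hv : v ∈ LieSubalgebra.lieSpan Φ L S) :
    ∃ w ∈ Submodule.span Φ S, ∃ d ∈ LieSubalgebra.lieSpan Φ L S,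
      d ∈ derivedSeries Φ L 1 ∧ v = w + d := by
  induction hv using LieSubalgebra.lieSpan_induction with
  | mem v hv => exact ⟨v, Submodule.subset_span hv, 0, zero_mem _, zero_mem _, (add_zero v).symm⟩
  | zero => exact ⟨0, zero_mem _, 0, zero_mem _, zero_mem _, (add_zero 0).symm⟩
  | add v v' _ _ ih ih' =>
    obtain ⟨w, hw, d, hd, hd1, rfl⟩ := ih
    obtain ⟨w', hw', d', hd', hd1', rfl⟩ := ih'
    exact ⟨w + w', add_mem hw hw', d + d', add_mem hd hd', add_mem hd1 hd1', by abel⟩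
  | smul a v _ ih =>
    obtain ⟨w, hw, d, hd, hd1, rfl⟩ := ih
    exact ⟨a • w, Submodule.smul_mem _ a hw, a • d, LieSubalgebra.smul_mem _ a hd,
      (derivedSeries Φ L 1).smul_mem a hd1, smul_add a w d⟩
  | lie v v' hv hv' _ _ =>
    exact ⟨0, zero_mem _, ⁅v, v'⁆, LieSubalgebra.lie_mem _ hv hv',
      lie_mem_derivedSeries_one v v', (zero_add _).symm⟩

lemma mem_lieSpan_range_xg (v : FreeLieThree Φ) :
    v ∈ LieSubalgebra.lieSpan Φ (FreeLieThree Φ) (Set.range (xg Φ)) := by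
  set K := LieSubalgebra.lieSpan Φ (FreeLieThree Φ) (Set.range (xg Φ))
  let F : FreeLieThree Φ →ₗ⁅Φ⁆ K :=
    FreeLieAlgebra.lift Φ fun i => ⟨xg Φ i, LieSubalgebra.subset_lieSpan ⟨i, rfl⟩⟩
  have h : K.incl.comp F = LieHom.id := lieHom_ext_xg fun i => by
    change ((F (FreeLieAlgebra.of Φ i) : K) : FreeLieThree Φ) = _
    rw [FreeLieAlgebra.lift_of_apply]
    rfl
  have hv : (F v : FreeLieThree Φ) = v := LieHom.congr_fun h v
  exact hv ▸ (F v).2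

lemma exists_linearCoord (i : Fin 3) : ∃ c : FreeLieThree Φ →ₗ[Φ] Φ,
    (∀ j, c (xg Φ j) = if j = i then 1 else 0) ∧
      ∀ d ∈ derivedSeries Φ (FreeLieThree Φ) 1, c d = 0 := by
  let := LieRing.ofAssociativeRing (A := Φ)
  let χ : LieCharacter Φ (FreeLieThree Φ) :=
    FreeLieAlgebra.lift Φ fun j => if j = i then 1 else 0
  exact ⟨χ, FreeLieAlgebra.lift_of_apply _, fun _ hd => lieCharacter_apply_of_mem_derived χ hd⟩

/-- The `i`-th coordinate of the linear part of an element of the free Lie algebra. -/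
noncomputable def linearCoord (i : Fin 3) : FreeLieThree Φ →ₗ[Φ] Φ :=
  (exists_linearCoord i).choose

lemma linearCoord_xg (i j : Fin 3) :
    linearCoord i (xg Φ j) = if j = i then 1 else 0 :=
  (exists_linearCoord i).choose_spec.1 j

lemma linearCoord_derived (i : Fin 3) {d : FreeLieThree Φ}
    (hd : d ∈ derivedSeries Φ (FreeLieThree Φ) 1) : linearCoord i d = 0 :=
  (exists_linearCoord i).choose_spec.2 d hd

lemma eq_sum_linearCoord {v : FreeLieThree Φ} (hv : v ∈ Submodule.span Φ (Set.range (xg Φ))) :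
    v = ∑ i, linearCoord i v • xg Φ i := by
  obtain ⟨c, rfl⟩ := (Submodule.mem_span_range_iff_exists_fun Φ).1 hv
  simp [linearCoord_xg]

lemma eq_of_linearCoord_eq {v w : FreeLieThree Φ}
    (hv : v ∈ Submodule.span Φ (Set.range (xg Φ)))
    (hw : w ∈ Submodule.span Φ (Set.range (xg Φ)))
    (h : ∀ i, linearCoord i v = linearCoord i w) : v = w := by
  rw [eq_sum_linearCoord hv, eq_sum_linearCoord hw]
  simp only [h]

lemma IsLinearAut.map_mem {e : FreeLieThreeAut Φ} (he : IsLinearAut Φ e) {v : FreeLieThree Φ}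
    (hv : v ∈ Submodule.span Φ (Set.range (xg Φ))) :
    e v ∈ Submodule.span Φ (Set.range (xg Φ)) := by
  obtain ⟨c, rfl⟩ := (Submodule.mem_span_range_iff_exists_fun Φ).1 hv
  simp only [map_sum, map_smul]
  exact sum_mem fun i _ => Submodule.smul_mem _ _ (he i)

lemma isLinearAut_one : IsLinearAut Φ (1 : FreeLieThreeAut Φ) :=
  fun i => Submodule.subset_span ⟨i, rfl⟩

lemma IsLinearAut.mul {e f : FreeLieThreeAut Φ} (he : IsLinearAut Φ e) (hf : IsLinearAut Φ f) :
    IsLinearAut Φ (e * f) :=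
  fun i => he.map_mem (hf i)

lemma IsLinearAut.inv {e : FreeLieThreeAut Φ} (he : IsLinearAut Φ e) : IsLinearAut Φ e⁻¹ := by
  intro i
  obtain ⟨w, hw, d, -, hd, hwd⟩ := exists_linear_add_derived (mem_lieSpan_range_xg (e⁻¹ (xg Φ i)))
  have key : e w = xg Φ i := by
    refine eq_of_linearCoord_eq (he.map_mem hw) (Submodule.subset_span ⟨i, rfl⟩) fun j => ?_
    rw [← lieAut_apply_inv_apply e (xg Φ i), hwd, map_add, map_add,
      linearCoord_derived j (map_mem_derivedSeries_one e hd), add_zero]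
  rwa [lieAut_inv_apply_eq key]

/-- The linear automorphisms preserving the span of the last two generators. -/
def tailStabilizer (Φ : Type*) [CommRing Φ] : Subgroup (FreeLieThreeAut Φ) where
  carrier := {e | IsLinearAut Φ e ∧
    ∀ v, e v ∈ Submodule.span Φ {xg Φ 1, xg Φ 2} ↔ v ∈ Submodule.span Φ {xg Φ 1, xg Φ 2}}
  mul_mem' ha hb := ⟨ha.1.mul hb.1, fun v => (ha.2 _).trans (hb.2 v)⟩
  one_mem' := ⟨isLinearAut_one, fun _ => Iff.rfl⟩
  inv_mem' {e} he := ⟨he.1.inv, fun v => by rw [← he.2, lieAut_apply_inv_apply]⟩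

lemma exists_coords_of_mem_tailStabilizer {e : FreeLieThreeAut Φ} (he : e ∈ tailStabilizer Φ) :
    ∃ α a₁ a₂ b₁ b₂ c₁ c₂ : Φ, e (xg Φ 0) = α • xg Φ 0 + (a₁ • xg Φ 1 + a₂ • xg Φ 2) ∧
      e (xg Φ 1) = b₁ • xg Φ 1 + b₂ • xg Φ 2 ∧ e (xg Φ 2) = c₁ • xg Φ 1 + c₂ • xg Φ 2 := by
  obtain ⟨b₁, b₂, hb⟩ := Submodule.mem_span_pair.1
    ((he.2 (xg Φ 1)).2 (Submodule.subset_span (by simp)))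
  obtain ⟨c₁, c₂, hc⟩ := Submodule.mem_span_pair.1
    ((he.2 (xg Φ 2)).2 (Submodule.subset_span (by simp)))
  refine ⟨linearCoord 0 (e (xg Φ 0)), linearCoord 1 (e (xg Φ 0)), linearCoord 2 (e (xg Φ 0)),
    b₁, b₂, c₁, c₂, (eq_sum_linearCoord (he.1 0)).trans ?_, hb.symm, hc.symm⟩
  rw [Fin.sum_univ_three, add_assoc]

lemma isTriangularAut_of_mem_tailStabilizer {e : FreeLieThreeAut Φ} (he : e ∈ tailStabilizer Φ) :
    IsTriangularAut Φ e := by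
  obtain ⟨α, a₁, a₂, b₁, b₂, c₁, c₂, h0, h1, h2⟩ := exists_coords_of_mem_tailStabilizer he
  obtain ⟨α', a₁', a₂', b₁', b₂', c₁', c₂', h0', h1', h2'⟩ :=
    exists_coords_of_mem_tailStabilizer (inv_mem he)
  have comp (i j : Fin 3) : linearCoord i (e (e⁻¹ (xg Φ j))) = if j = i then 1 else 0 := by
    rw [lieAut_apply_inv_apply, linearCoord_xg]
  have k00 := comp 0 0
  have k11 := comp 1 1
  have k21 := comp 2 1
  have k12 := comp 1 2
  have k22 := comp 2 2
  simp [h0, h1, h2, h0', h1', h2', linearCoord_xg] at k00 k11 k21 k12 k22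
  refine ⟨α, b₁, b₂, c₁, c₂, a₁ • xg Φ 1 + a₂ • xg Φ 2, .of_mul_eq_one α' ?_,
    .of_mul_eq_one (b₁' * c₂' - b₂' * c₁') ?_, ?_, h0, h1, h2⟩
  · linear_combination k00
  · linear_combination (b₂ * c₁' + c₂ * c₂') * k11 - (b₁ * c₁' + c₁ * c₂') * k21 + k22
  · exact LieSubalgebra.submodule_span_le_lieSpan (Submodule.mem_span_pair.2 ⟨a₁, a₂, rfl⟩)

lemma mem_tailStabilizer_iff {e : FreeLieThreeAut Φ} :
    e ∈ tailStabilizer Φ ↔ IsLinearAut Φ e ∧ IsTriangularAut Φ e := by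
  refine ⟨fun he => ⟨he.1, isTriangularAut_of_mem_tailStabilizer he⟩, ?_⟩
  rintro ⟨hlin, α, b₁, b₂, c₁, c₂, h, -, hu, -, -, h1, h2⟩
  obtain ⟨u, hu⟩ := hu.exists_right_inv
  have maps {f : FreeLieThreeAut Φ} {s₁ s₂ t₁ t₂ : Φ}
      (hf1 : f (xg Φ 1) = s₁ • xg Φ 1 + s₂ • xg Φ 2)
      (hf2 : f (xg Φ 2) = t₁ • xg Φ 1 + t₂ • xg Φ 2) {v : FreeLieThree Φ}
      (hv : v ∈ Submodule.span Φ {xg Φ 1, xg Φ 2}) :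
      f v ∈ Submodule.span Φ {xg Φ 1, xg Φ 2} := by
    obtain ⟨p, q, rfl⟩ := Submodule.mem_span_pair.1 hv
    refine Submodule.mem_span_pair.2 ⟨p * s₁ + q * t₁, p * s₂ + q * t₂, ?_⟩
    rw [map_add, map_smul, map_smul, hf1, hf2]
    module
  refine ⟨hlin, fun v => ⟨fun hv => ?_, maps h1 h2⟩⟩
  have g1 : e⁻¹ (xg Φ 1) = (u * c₂) • xg Φ 1 + (-(u * b₂)) • xg Φ 2 := by
    refine lieAut_inv_apply_eq ?_
    rw [map_add, map_smul, map_smul, h1, h2]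
    linear_combination (norm := module) hu • xg Φ 1
  have g2 : e⁻¹ (xg Φ 2) = (-(u * c₁)) • xg Φ 1 + (u * b₁) • xg Φ 2 := by
    refine lieAut_inv_apply_eq ?_
    rw [map_add, map_smul, map_smul, h1, h2]
    linear_combination (norm := module) hu • xg Φ 2
  rw [← lieAut_inv_apply_apply e v]
  exact maps g1 g2 hv

lemma lieHom_fixes_lieSpan {F : FreeLieThree Φ →ₗ⁅Φ⁆ FreeLieThree Φ}
    (h1 : F (xg Φ 1) = xg Φ 1) (h2 : F (xg Φ 2) = xg Φ 2) {v : FreeLieThree Φ}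
    (hv : v ∈ LieSubalgebra.lieSpan Φ (FreeLieThree Φ) {xg Φ 1, xg Φ 2}) : F v = v := by
  induction hv using LieSubalgebra.lieSpan_induction with
  | mem v hv => obtain rfl | rfl := hv <;> assumption
  | zero => exact map_zero F
  | add v w _ _ hv hw => rw [map_add, hv, hw]
  | smul a v _ hv => rw [map_smul, hv]
  | lie v w _ _ hv hw => rw [LieHom.map_lie, hv, hw]

lemma lieAut_fixes_lieSpan {e : FreeLieThreeAut Φ}
    (h1 : e (xg Φ 1) = xg Φ 1) (h2 : e (xg Φ 2) = xg Φ 2) {v : FreeLieThree Φ}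
    (hv : v ∈ LieSubalgebra.lieSpan Φ (FreeLieThree Φ) {xg Φ 1, xg Φ 2}) : e v = v :=
  lieHom_fixes_lieSpan (F := e.toLieHom) h1 h2 hv

lemma lieAut_map_lieSpan (e : FreeLieThreeAut Φ) {S T : Set (FreeLieThree Φ)}
    (hST : ∀ s ∈ S, e s ∈ LieSubalgebra.lieSpan Φ (FreeLieThree Φ) T) {v : FreeLieThree Φ}
    (hv : v ∈ LieSubalgebra.lieSpan Φ (FreeLieThree Φ) S) :
    e v ∈ LieSubalgebra.lieSpan Φ (FreeLieThree Φ) T :=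
  (LieSubalgebra.lieSpan_le (K := (LieSubalgebra.lieSpan Φ (FreeLieThree Φ) T).comap e.toLieHom)).2
    hST hv

lemma IsB0Aut.mul {s t : FreeLieThreeAut Φ} (hs : IsB0Aut Φ s) (ht : IsB0Aut Φ t) :
    IsB0Aut Φ (s * t) := by
  obtain ⟨f, hf, hfd, s0, s1, s2⟩ := hs
  obtain ⟨g, hg, hgd, t0, t1, t2⟩ := ht
  refine ⟨f + g, add_mem hf hg, add_mem hfd hgd, ?_, ?_, ?_⟩
  · rw [lieAut_mul_apply, t0, map_add, s0, lieAut_fixes_lieSpan s1 s2 hg, add_assoc]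
  · rw [lieAut_mul_apply, t1, s1]
  · rw [lieAut_mul_apply, t2, s2]

lemma IsB0Aut.inv {s : FreeLieThreeAut Φ} (hs : IsB0Aut Φ s) : IsB0Aut Φ s⁻¹ := by
  obtain ⟨f, hf, hfd, s0, s1, s2⟩ := hs
  refine ⟨-f, neg_mem hf, neg_mem hfd, lieAut_inv_apply_eq ?_, lieAut_inv_apply_eq s1,
    lieAut_inv_apply_eq s2⟩
  rw [map_add, s0, lieAut_fixes_lieSpan s1 s2 (neg_mem hf), add_neg_cancel_right]

lemma IsB0Aut.conj {s h : FreeLieThreeAut Φ} (hs : IsB0Aut Φ s) (hh : h ∈ tailStabilizer Φ) :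
    IsB0Aut Φ (h * s * h⁻¹) := by
  obtain ⟨f, hf, hfd, s0, s1, s2⟩ := hs
  obtain ⟨α, a₁, a₂, b₁, b₂, c₁, c₂, h0, h1, h2⟩ :=
    exists_coords_of_mem_tailStabilizer (inv_mem hh)
  have hx (i : Fin 3) : (h * s * h⁻¹) (xg Φ i) = h (s (h⁻¹ (xg Φ i))) := rfl
  refine ⟨α • h f, LieSubalgebra.smul_mem _ _ (lieAut_map_lieSpan h (fun v hv => ?_) hf),
    (derivedSeries Φ (FreeLieThree Φ) 1).smul_mem _ (map_mem_derivedSeries_one h hfd), ?_, ?_, ?_⟩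
  · exact LieSubalgebra.submodule_span_le_lieSpan ((hh.2 v).2 (Submodule.subset_span hv))
  · have : s (h⁻¹ (xg Φ 0)) = h⁻¹ (xg Φ 0) + α • f := by
      rw [h0]
      simp only [map_add, map_smul, s0, s1, s2]
      module
    rw [hx, this, map_add, map_smul, lieAut_apply_inv_apply]
  · have : s (h⁻¹ (xg Φ 1)) = h⁻¹ (xg Φ 1) := by
      simp only [h1, map_add, map_smul, s1, s2]
    rw [hx, this, lieAut_apply_inv_apply]
  · have : s (h⁻¹ (xg Φ 2)) = h⁻¹ (xg Φ 2) := by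
      simp only [h2, map_add, map_smul, s1, s2]
    rw [hx, this, lieAut_apply_inv_apply]

lemma exists_isB0Aut {f : FreeLieThree Φ}
    (hf : f ∈ LieSubalgebra.lieSpan Φ (FreeLieThree Φ) {xg Φ 1, xg Φ 2})
    (hfd : f ∈ derivedSeries Φ (FreeLieThree Φ) 1) :
    ∃ t : FreeLieThreeAut Φ, IsB0Aut Φ t ∧ t (xg Φ 0) = xg Φ 0 + f := by
  have fix (g : FreeLieThree Φ) :
      FreeLieAlgebra.lift Φ ![xg Φ 0 + g, xg Φ 1, xg Φ 2] f = f :=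
    lieHom_fixes_lieSpan (by simp [lift_xg]) (by simp [lift_xg]) hf
  obtain ⟨t, ht⟩ := exists_lieAut ![xg Φ 0 + f, xg Φ 1, xg Φ 2] ![xg Φ 0 + -f, xg Φ 1, xg Φ 2]
    (by intro i; fin_cases i <;> simp [lift_xg, fix])
    (by intro i; fin_cases i <;> simp [lift_xg, fix])
  exact ⟨t, ⟨f, hf, hfd, ht 0, ht 1, ht 2⟩, ht 0⟩

lemma exists_permutation_lieAut (i : Fin 3) : ∃ p : FreeLieThreeAut Φ,
    ∀ j, p (xg Φ j) = xg Φ (Equiv.swap 0 i j) :=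
  exists_lieAut (fun j => xg Φ (Equiv.swap 0 i j)) (fun j => xg Φ (Equiv.swap 0 i j))
    (fun j => by simp [lift_xg]) (fun j => by simp [lift_xg])

lemma IsElementaryAut.exists_factorization {e : FreeLieThreeAut Φ} (he : IsElementaryAut Φ e) :
    ∃ g t g' : FreeLieThreeAut Φ, IsLinearAut Φ g ∧ IsB0Aut Φ t ∧ IsLinearAut Φ g' ∧
      e = g * t * g' := by
  obtain ⟨i, α, f, ⟨α, rfl⟩, hf, hi, hj⟩ := he
  obtain ⟨p, hp⟩ := exists_permutation_lieAut (Φ := Φ) i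
  have hpinv (j : Fin 3) : p⁻¹ (xg Φ j) = xg Φ (Equiv.swap 0 i j) :=
    lieAut_inv_apply_eq (by rw [hp, Equiv.swap_apply_self])
  have hplin : IsLinearAut Φ p := fun j => hp j ▸ Submodule.subset_span ⟨_, rfl⟩
  have hf' : p⁻¹ f ∈ LieSubalgebra.lieSpan Φ (FreeLieThree Φ) {xg Φ 1, xg Φ 2} := by
    refine lieAut_map_lieSpan p⁻¹ ?_ hf
    rintro _ ⟨j, hji, rfl⟩
    rw [hpinv]
    refine LieSubalgebra.subset_lieSpan ?_
    have : Equiv.swap 0 i j ≠ 0 := by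
      rw [Ne, Equiv.swap_apply_eq_iff, Equiv.swap_apply_left]
      exact hji
    generalize Equiv.swap 0 i j = k at this
    fin_cases k <;> simp_all
  obtain ⟨w, hw, d, hd, hdd, hwd⟩ := exists_linear_add_derived hf'
  obtain ⟨t, ht, ht0⟩ := exists_isB0Aut (f := (↑α⁻¹ : Φ) • d)
    (LieSubalgebra.smul_mem _ _ hd) ((derivedSeries Φ (FreeLieThree Φ) 1).smul_mem _ hdd)
  have fix {v : FreeLieThree Φ}
      (hv : v ∈ LieSubalgebra.lieSpan Φ (FreeLieThree Φ) {xg Φ 1, xg Φ 2}) : t⁻¹ v = v :=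
    let ⟨_, _, _, _, t1, t2⟩ := ht
    lieAut_inv_apply_eq (lieAut_fixes_lieSpan t1 t2 hv)
  have hq (j : Fin 3) : (t⁻¹ * p⁻¹ * e * p) (xg Φ j) = t⁻¹ (p⁻¹ (e (p (xg Φ j)))) := rfl
  have hlin : IsLinearAut Φ (t⁻¹ * p⁻¹ * e * p) := by
    intro j
    rw [hq, hp]
    by_cases hj0 : j = 0
    · subst hj0
      have : t⁻¹ (xg Φ 0) = xg Φ 0 - (↑α⁻¹ : Φ) • d := by
        refine lieAut_inv_apply_eq ?_
        rw [map_sub, ht0, map_smul, lieAut_fixes_lieSpan ht.choose_spec.2.2.2.1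
          ht.choose_spec.2.2.2.2 hd, add_sub_cancel_right]
      rw [Equiv.swap_apply_left, hi, map_add, map_smul, hpinv, Equiv.swap_apply_right, hwd,
        map_add, map_smul, map_add, fix hd,
        fix (LieSubalgebra.submodule_span_le_lieSpan hw), this, smul_sub, smul_smul,
        Units.mul_inv, one_smul, add_comm w, ← add_assoc, sub_add_cancel]
      exact add_mem (Submodule.smul_mem _ _ (Submodule.subset_span ⟨0, rfl⟩))
        (Submodule.span_mono (by rintro _ (rfl | rfl) <;> exact ⟨_, rfl⟩) hw)
    · have hne : Equiv.swap 0 i j ≠ i := by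
        rw [Ne, Equiv.swap_apply_eq_iff, Equiv.swap_apply_right]
        exact hj0
      rw [hj _ hne, hpinv, Equiv.swap_apply_self, fix]
      · exact Submodule.subset_span ⟨j, rfl⟩
      · refine LieSubalgebra.subset_lieSpan ?_
        fin_cases j <;> simp_all
  exact ⟨p, t, t⁻¹ * p⁻¹ * e * p * p⁻¹, hplin, ht, hlin.mul hplin.inv, by group⟩

/-- The products `σ₁τ₁⋯σₖτₖλ` with all `σᵢ ∈ A₀` and `τᵢ ∈ B₀` nontrivial and `λ` linear. -/
inductive IsReducedWord (A0 : Set (FreeLieThreeAut Φ)) : FreeLieThreeAut Φ → Prop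
  | linear {e : FreeLieThreeAut Φ} : IsLinearAut Φ e → IsReducedWord A0 e
  | cons {s t e : FreeLieThreeAut Φ} : s ∈ A0 → s ≠ 1 → IsB0Aut Φ t → t ≠ 1 →
      IsReducedWord A0 e → IsReducedWord A0 (s * t * e)

/-- Like `IsReducedWord`, but the leading coset representative may be trivial. -/
def HasNormalForm (A0 : Set (FreeLieThreeAut Φ)) (e : FreeLieThreeAut Φ) : Prop :=
  IsLinearAut Φ e ∨ ∃ s t e' : FreeLieThreeAut Φ,
    s ∈ A0 ∧ IsB0Aut Φ t ∧ t ≠ 1 ∧ IsReducedWord A0 e' ∧ e = s * t * e'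

variable {A0 : Set (FreeLieThreeAut Φ)}

lemma IsReducedWord.hasNormalForm {e : FreeLieThreeAut Φ} (he : IsReducedWord A0 e) :
    HasNormalForm A0 e := by
  cases he with
  | linear h => exact .inl h
  | cons hs _ ht ht1 he => exact .inr ⟨_, _, _, hs, ht, ht1, he, rfl⟩

lemma IsA0System.exists_mul_eq (hA0 : IsA0System Φ A0) {g : FreeLieThreeAut Φ}
    (hg : IsLinearAut Φ g) : ∃ a ∈ A0, ∃ h ∈ tailStabilizer Φ, g = a * h := by
  obtain ⟨a, ha, h⟩ := hA0.2.2.1 g hg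
  exact ⟨a, ha, a⁻¹ * g, mem_tailStabilizer_iff.2 h, (mul_inv_cancel_left a g).symm⟩

lemma IsA0System.eq_one (hA0 : IsA0System Φ A0) {a : FreeLieThreeAut Φ} (ha : a ∈ A0)
    (h : a ∈ tailStabilizer Φ) : a = 1 := by
  by_contra hne
  refine hA0.2.2.2 a ha 1 hA0.1 hne (mem_tailStabilizer_iff.1 ?_)
  exact mul_mem (inv_mem h) (one_mem (tailStabilizer Φ))

lemma mul_mul_eq_conj {G : Type*} [Group G] {g s a h : G} (hgs : g * s = a * h) (t e : G) :
    g * (s * t * e) = a * (h * t * h⁻¹) * (h * e) := by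
  calc g * (s * t * e) = g * s * t * e := by group
    _ = _ := by rw [hgs]; group

lemma IsReducedWord.tailStabilizer_mul (hA0 : IsA0System Φ A0) {e : FreeLieThreeAut Φ}
    (he : IsReducedWord A0 e) {g : FreeLieThreeAut Φ} (hg : g ∈ tailStabilizer Φ) :
    IsReducedWord A0 (g * e) := by
  induction he generalizing g with
  | linear he => exact .linear (hg.1.mul he)
  | @cons s t e hs hs1 ht ht1 _ ih =>
    obtain ⟨a, ha, h, hh, hgs⟩ := hA0.exists_mul_eq (hg.1.mul (hA0.2.1 s hs))
    rw [mul_mul_eq_conj hgs]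
    refine .cons ha ?_ (ht.conj hh) (fun hc => ht1 (conj_eq_one_iff.1 hc)) (ih hh)
    rintro rfl
    refine hs1 (hA0.eq_one hs ?_)
    rw [← inv_mul_cancel_left g s, hgs]
    exact mul_mem (inv_mem hg) (mul_mem (one_mem _) hh)

lemma HasNormalForm.linear_mul (hA0 : IsA0System Φ A0) {e : FreeLieThreeAut Φ}
    (he : HasNormalForm A0 e) {g : FreeLieThreeAut Φ} (hg : IsLinearAut Φ g) :
    HasNormalForm A0 (g * e) := by
  obtain he | ⟨s, t, e, hs, ht, ht1, he, rfl⟩ := he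
  · exact .inl (hg.mul he)
  · obtain ⟨a, ha, h, hh, hgs⟩ := hA0.exists_mul_eq (hg.mul (hA0.2.1 s hs))
    exact .inr ⟨a, h * t * h⁻¹, h * e, ha, ht.conj hh, fun hc => ht1 (conj_eq_one_iff.1 hc),
      he.tailStabilizer_mul hA0 hh, mul_mul_eq_conj hgs t e⟩

lemma IsReducedWord.b0_mul (hA0 : IsA0System Φ A0) {e t : FreeLieThreeAut Φ}
    (he : IsReducedWord A0 e) (ht : IsB0Aut Φ t) : HasNormalForm A0 (t * e) := by
  by_cases ht1 : t = 1
  · rw [ht1]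
    exact he.hasNormalForm
  · exact .inr ⟨1, t, e, hA0.1, ht, ht1, he, rfl⟩

lemma HasNormalForm.b0_mul (hA0 : IsA0System Φ A0) {e t : FreeLieThreeAut Φ}
    (he : HasNormalForm A0 e) (ht : IsB0Aut Φ t) : HasNormalForm A0 (t * e) := by
  obtain he | ⟨s, t', e, hs, ht', ht1', he, rfl⟩ := he
  · exact (IsReducedWord.linear he).b0_mul hA0 ht
  · by_cases hs1 : s = 1
    · subst hs1
      exact he.b0_mul hA0 (ht.mul ht')
    · exact (IsReducedWord.cons hs hs1 ht' ht1' he).b0_mul hA0 ht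

lemma IsTameAut.hasNormalForm (hA0 : IsA0System Φ A0) {e : FreeLieThreeAut Φ}
    (he : IsTameAut Φ e) : HasNormalForm A0 e := by
  have key : (∀ f, HasNormalForm A0 f → HasNormalForm A0 (e * f)) ∧
      ∀ f, HasNormalForm A0 f → HasNormalForm A0 (e⁻¹ * f) := by
    induction he using Subgroup.closure_induction with
    | mem e he =>
      obtain ⟨g, t, g', hg, ht, hg', rfl⟩ := IsElementaryAut.exists_factorization he
      exact ⟨fun f hf => ((hf.linear_mul hA0 hg').b0_mul hA0 ht).linear_mul hA0 hg,
        fun f hf => ((hf.linear_mul hA0 hg.inv).b0_mul hA0 ht.inv).linear_mul hA0 hg'.inv⟩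
    | one => exact ⟨fun f hf => hf, fun f hf => hf⟩
    | mul a b _ _ iha ihb =>
      exact ⟨fun f hf => iha.1 _ (ihb.1 f hf), fun f hf => ihb.2 _ (iha.2 f hf)⟩
    | inv a _ ih => exact ⟨ih.2, ih.1⟩
  exact key.1 1 (.inl isLinearAut_one)

lemma prod_range_cons {M : Type*} [Mul M] [One M] (σ τ : ℕ → M) (s t : M) (k : ℕ) :
    ((List.range (k + 1)).map fun j =>
      (Nat.rec s (fun n _ => σ n) j : M) * (Nat.rec t (fun n _ => τ n) j : M)).prod =
      s * t * ((List.range k).map fun j => σ j * τ j).prod := by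
  rw [List.range_succ_eq_map, List.map_cons, List.prod_cons, List.map_map]
  rfl

lemma IsReducedWord.exists_word {e : FreeLieThreeAut Φ} (he : IsReducedWord A0 e) :
    ∃ (k : ℕ) (σ τ : ℕ → FreeLieThreeAut Φ) (lam : FreeLieThreeAut Φ),
      (∀ j < k, σ j ∈ A0 ∧ σ j ≠ 1) ∧ (∀ j < k, IsB0Aut Φ (τ j) ∧ τ j ≠ 1) ∧
      IsLinearAut Φ lam ∧ e = ((List.range k).map fun j => σ j * τ j).prod * lam := by
  induction he with
  | @linear e he => exact ⟨0, fun _ => 1, fun _ => 1, e, by simp, by simp, he, rfl⟩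
  | @cons s t e hs hs1 ht ht1 _ ih =>
    obtain ⟨k, σ, τ, lam, hσ, hτ, hlam, rfl⟩ := ih
    refine ⟨k + 1, fun j => Nat.rec s (fun n _ => σ n) j, fun j => Nat.rec t (fun n _ => τ n) j, lam,
      ?_, ?_, hlam, ?_⟩
    · rintro (_ | j) hj
      exacts [⟨hs, hs1⟩, hσ j (by omega)]
    · rintro (_ | j) hj
      exacts [⟨ht, ht1⟩, hτ j (by omega)]
    · rw [← mul_assoc, ← prod_range_cons]

end FreeLieThree

/-- Every tame automorphism `φ` of `L_3(Φ)` over an integral domain `Φ` can be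
written as `φ = σ₁ ∘ τ₁ ∘ σ₂ ∘ τ₂ ∘ ⋯ ∘ σ_k ∘ τ_k ∘ λ` where the `σ` are in the
fixed system `A₀` of coset representatives with `σ₂, …, σ_k ≠ id` (indices shifted
down by one: `σ j` here is `σ_{j+1}`), the `τ` are nonidentity elements of `B₀`,
and `λ` is a linear automorphism. -/
theorem tame_aut_normal_form
    (Φ : Type*) [CommRing Φ] [IsDomain Φ]
    (A0 : Set (FreeLieAlgebra Φ (Fin 3) ≃ₗ⁅Φ⁆ FreeLieAlgebra Φ (Fin 3)))
    (hA0 : IsA0System Φ A0)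
    (φ : FreeLieAlgebra Φ (Fin 3) ≃ₗ⁅Φ⁆ FreeLieAlgebra Φ (Fin 3))
    (hφ : IsTameAut Φ φ) :
    ∃ (k : ℕ) (σ τ : ℕ → (FreeLieAlgebra Φ (Fin 3) ≃ₗ⁅Φ⁆ FreeLieAlgebra Φ (Fin 3)))
      (lam : FreeLieAlgebra Φ (Fin 3) ≃ₗ⁅Φ⁆ FreeLieAlgebra Φ (Fin 3)),
      (∀ j < k, σ j ∈ A0) ∧
      (∀ j, 1 ≤ j → j < k → σ j ≠ 1) ∧
      (∀ j < k, IsB0Aut Φ (τ j) ∧ τ j ≠ 1) ∧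
      IsLinearAut Φ lam ∧
      φ = ((List.range k).map (fun j => σ j * τ j)).prod * lam := by
  obtain hφ | ⟨s, t, e, hs, ht, ht1, he, rfl⟩ := hφ.hasNormalForm hA0
  · exact ⟨0, fun _ => 1, fun _ => 1, φ, by simp, by simp, by simp, hφ, rfl⟩
  · obtain ⟨k, σ, τ, lam, hσ, hτ, hlam, rfl⟩ := he.exists_word
    refine ⟨k + 1, fun j => Nat.rec s (fun n _ => σ n) j, fun j => Nat.rec t (fun n _ => τ n) j, lam,
      ?_, ?_, ?_, hlam, ?_⟩
    · rintro (_ | j) hj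
      exacts [hs, (hσ j (by omega)).1]
    · rintro (_ | j) hj1 hj
      exacts [absurd hj1 (by omega), (hσ j (by omega)).2]
    · rintro (_ | j) hj
      exacts [⟨ht, ht1⟩, hτ j (by omega)]
    · rw [← mul_assoc, ← prod_range_cons]
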